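/- For all 0 ≤ r < s < t and all R > 0: ∫_ℝ ∫_ℝ ∫_{[−R,R]⁴} p_{t−s}(x−y)·p_{t−s}(x̃−y)·p_{t−s}(x′−y′)·p_{t−s}(x̃′−y′)·p_{2(s−r)}(y−y′) dx dx̃ dx′ dx̃′ dy dy′ ≤ 2R, where the inner integral is over (x, x̃, x′, x̃′) ∈ [−R,R]⁴ and the outer integrals are over y, y′ ∈ ℝ. -/

import Mathlib

open MeasureTheory

/-- The one-dimensional heat kernel `p_t(x) = (2πt)^{-1/2} exp(-x²/(2t))`. -/
noncomputable def heatKernel (t x : ℝ) : ℝ :=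
  (Real.sqrt (2 * Real.pi * t))⁻¹ * Real.exp (-x ^ 2 / (2 * t))

section HeatKernel

theorem heatKernel_eq_gaussianPDFReal {t : ℝ} (ht : 0 ≤ t) (x : ℝ) :
    heatKernel t x = ProbabilityTheory.gaussianPDFReal 0 ⟨t, ht⟩ x := by
  simp only [heatKernel, ProbabilityTheory.gaussianPDFReal, sub_zero]
  rfl

theorem heatKernel_nonneg (t x : ℝ) : 0 ≤ heatKernel t x := by
  unfold heatKernel
  positivity

theorem continuous_heatKernel (t : ℝ) : Continuous (heatKernel t) := by
  unfold heatKernel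
  fun_prop

theorem integrable_heatKernel {t : ℝ} (ht : 0 ≤ t) : Integrable (heatKernel t) := by
  rw [funext (heatKernel_eq_gaussianPDFReal ht)]
  exact ProbabilityTheory.integrable_gaussianPDFReal 0 _

theorem integral_heatKernel {t : ℝ} (ht : 0 < t) : ∫ x, heatKernel t x = 1 := by
  rw [funext (heatKernel_eq_gaussianPDFReal ht.le)]
  exact ProbabilityTheory.integral_gaussianPDFReal_eq_one 0 fun h =>
    ht.ne' (congrArg NNReal.toReal h)

/-- The heat flow of the indicator of `A`. -/
noncomputable def heatMass (t : ℝ) (A : Set ℝ) (y : ℝ) : ℝ :=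
  ∫ x in A, heatKernel t (x - y)

theorem heatMass_nonneg (t : ℝ) (A : Set ℝ) (y : ℝ) : 0 ≤ heatMass t A y :=
  integral_nonneg fun _ => heatKernel_nonneg _ _

theorem heatMass_le_one {t : ℝ} (ht : 0 < t) (A : Set ℝ) (y : ℝ) : heatMass t A y ≤ 1 := by
  rw [← integral_heatKernel ht, ← integral_sub_right_eq_self (heatKernel t) y]
  exact setIntegral_le_integral ((integrable_heatKernel ht.le).comp_sub_right y)
    (Filter.Eventually.of_forall fun _ => heatKernel_nonneg _ _)

theorem integral_heatKernel_sub_left {t : ℝ} (ht : 0 < t) (x : ℝ) :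
    ∫ y, heatKernel t (x - y) = 1 := by
  rw [integral_sub_left_eq_self, integral_heatKernel ht]

theorem integrable_heatKernel_sub_prod {t : ℝ} (ht : 0 < t) (A : Set ℝ) (hA : volume A ≠ ⊤) :
    Integrable (fun z : ℝ × ℝ => heatKernel t (z.2 - z.1))
      (volume.prod (volume.restrict A)) := by
  have : IsFiniteMeasure (volume.restrict A) := isFiniteMeasure_restrict.2 hA
  have hcont : Continuous fun z : ℝ × ℝ => heatKernel t (z.2 - z.1) :=
    (continuous_heatKernel t).comp (by fun_prop)
  rw [integrable_prod_iff' hcont.aestronglyMeasurable]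
  refine ⟨Filter.Eventually.of_forall fun x => (integrable_heatKernel ht.le).comp_sub_left x, ?_⟩
  simp only [Real.norm_of_nonneg (heatKernel_nonneg _ _), integral_heatKernel_sub_left ht]
  exact integrable_const 1

theorem integrable_heatMass {t : ℝ} (ht : 0 < t) (A : Set ℝ) (hA : volume A ≠ ⊤) :
    Integrable (heatMass t A) :=
  (integrable_heatKernel_sub_prod ht A hA).integral_prod_left

theorem integral_heatMass {t : ℝ} (ht : 0 < t) (A : Set ℝ) (hA : volume A ≠ ⊤) :
    ∫ y, heatMass t A y = volume.real A := by
  have : IsFiniteMeasure (volume.restrict A) := isFiniteMeasure_restrict.2 hA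
  unfold heatMass
  rw [integral_integral_swap (integrable_heatKernel_sub_prod ht A hA)]
  simp [integral_heatKernel_sub_left ht]

end HeatKernel

/-- The analytic core of the estimate of the term `A₁` in the proof of Theorem 1.1:
for `0 ≤ r < s < t` and `R > 0`, the six-fold Gaussian integral
`∫_{ℝ²} ∫_{[-R,R]⁴} p_{t-s}(x-y) p_{t-s}(x̃-y) p_{t-s}(x'-y') p_{t-s}(x̃'-y')
  p_{2(s-r)}(y-y') dx dx̃ dx' dx̃' dy dy'` is bounded by `2R`. -/
theorem A1_core_bound (r s t R : ℝ) (hr : 0 ≤ r) (hrs : r < s) (hst : s < t) (hR : 0 < R) :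
    (∫ y : ℝ, ∫ y' : ℝ,
      ∫ x in Set.Icc (-R) R, ∫ xt in Set.Icc (-R) R,
        ∫ x' in Set.Icc (-R) R, ∫ xt' in Set.Icc (-R) R,
          heatKernel (t - s) (x - y) * heatKernel (t - s) (xt - y) *
          heatKernel (t - s) (x' - y') * heatKernel (t - s) (xt' - y') *
          heatKernel (2 * (s - r)) (y - y'))
      ≤ 2 * R := by
  have hts : 0 < t - s := sub_pos.2 hst
  have hsr : 0 < 2 * (s - r) := by linarith
  set A := Set.Icc (-R) R
  have hA : volume A ≠ ⊤ := measure_Icc_lt_top.ne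
  set F := heatMass (t - s) A with hF
  have hF0 : ∀ y, 0 ≤ F y := heatMass_nonneg (t - s) A
  have hF1 : ∀ y, F y ≤ 1 := heatMass_le_one hts A
  have hinner : ∀ y y' : ℝ, (∫ x in A, ∫ xt in A, ∫ x' in A, ∫ xt' in A,
      heatKernel (t - s) (x - y) * heatKernel (t - s) (xt - y) *
      heatKernel (t - s) (x' - y') * heatKernel (t - s) (xt' - y') *
      heatKernel (2 * (s - r)) (y - y')) =
      F y * F y * F y' * F y' * heatKernel (2 * (s - r)) (y - y') := fun y y' => by
    simp only [integral_mul_const, integral_const_mul, hF, heatMass]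
  simp only [hinner]
  have hbound : ∀ y y' : ℝ, F y * F y * F y' * F y' * heatKernel (2 * (s - r)) (y - y') ≤
      F y * heatKernel (2 * (s - r)) (y - y') := fun y y' => by
    refine mul_le_mul_of_nonneg_right ?_ (heatKernel_nonneg _ _)
    have h := mul_le_one₀ (mul_le_one₀ (hF1 y) (hF0 y') (hF1 y')) (hF0 y') (hF1 y')
    calc F y * F y * F y' * F y' = F y * (F y * F y' * F y') := by ring
      _ ≤ F y := mul_le_of_le_one_right (hF0 y) h
  have hnonneg : ∀ y y' : ℝ,
      0 ≤ F y * F y * F y' * F y' * heatKernel (2 * (s - r)) (y - y') := fun y y' => by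
    have := hF0 y
    have := hF0 y'
    have := heatKernel_nonneg (2 * (s - r)) (y - y')
    positivity
  calc _ ≤ ∫ y, F y := by
        refine integral_mono_of_nonneg
          (Filter.Eventually.of_forall fun y => integral_nonneg (hnonneg y))
          (integrable_heatMass hts A hA) (Filter.Eventually.of_forall fun y => ?_)
        calc _ ≤ ∫ y', F y * heatKernel (2 * (s - r)) (y - y') :=
              integral_mono_of_nonneg (Filter.Eventually.of_forall (hnonneg y))
                (((integrable_heatKernel hsr.le).comp_sub_left y).const_mul _)
                (Filter.Eventually.of_forall (hbound y))
          _ = F y := by rw [integral_const_mul, integral_heatKernel_sub_left hsr, mul_one]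
    _ = 2 * R := by
        rw [integral_heatMass hts A hA, Real.volume_real_Icc_of_le (by linarith)]
        ring
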